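/- Let F(X,Y) be a propositional CNF formula whose set F^X of X-clauses is nonempty, and let G be a nonempty subset of F^X. Then G is NOT redundant in ∃X.F if and only if there exists a Z-boundary point p of F, with Z ⊆ X, such that (a) every clause of F falsified by p belongs to G and (b) p is X-removable in F. -/

import Mathlib

namespace QE

noncomputable section

attribute [local instance] Classical.propDecidable

/-- A literal: a variable together with a polarity. -/
structure Lit (V : Type) where
  var : V
  pos : Bool
deriving DecidableEq

variable {V : Type} [DecidableEq V]

/-- A clause is a (finite) disjunction of literals. -/
abbrev Clause (V : Type) := Finset (Lit V)

/-- A CNF formula is a (finite) set of clauses. -/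
abbrev Cnf (V : Type) := Finset (Clause V)

/-- The variables of a clause. -/
def Clause.vars (C : Clause V) : Finset V := C.image Lit.var

/-- The variables of a CNF formula. -/
def Cnf.vars (F : Cnf V) : Finset V := F.sup Clause.vars

/-- A total assignment (point) `t` satisfies the clause `C`. -/
def Clause.satAt (t : V → Bool) (C : Clause V) : Prop := ∃ l ∈ C, t l.var = l.pos

/-- A total assignment (point) `t` falsifies the clause `C`. -/
def Clause.falsAt (t : V → Bool) (C : Clause V) : Prop := ∀ l ∈ C, t l.var = !l.pos

/-- A total assignment (point) `t` satisfies the CNF formula `F`. -/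
def Cnf.satAt (t : V → Bool) (F : Cnf V) : Prop := ∀ C ∈ F, Clause.satAt t C

/-- A partial assignment: it assigns Boolean values to some of the variables. -/
abbrev PAssign (V : Type) := V → Option Bool

/-- The set of variables assigned in `q`. -/
def PAssign.dom (q : PAssign V) : Set V := {v | q v ≠ none}

/-- `q ⊆ r` for partial assignments (viewed as sets of value assignments). -/
def PAssign.le (q r : PAssign V) : Prop := ∀ v b, q v = some b → r v = some b

/-- `q ⊊ r` for partial assignments. -/
def PAssign.lt (q r : PAssign V) : Prop := PAssign.le q r ∧ q ≠ r

/-- The point (total assignment) `t` extends the partial assignment `q`. -/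
def ExtendsPnt (t : V → Bool) (q : PAssign V) : Prop := ∀ v b, q v = some b → t v = b

/-- Two partial assignments are compatible if every commonly assigned
variable gets the same value in both. -/
def PAssign.compatible (q r : PAssign V) : Prop :=
  ∀ v b b', q v = some b → r v = some b' → b = b'

/-- The union of two partial assignments. -/
def PAssign.union (q r : PAssign V) : PAssign V := fun v => (q v).orElse fun _ => r v

/-- The clause `C` is satisfied by the partial assignment `q`. -/
def Clause.satBy (q : PAssign V) (C : Clause V) : Prop := ∃ l ∈ C, q l.var = some l.pos

/-- The cofactor `C|_q` of an (unsatisfied) clause: remove the literals falsified by `q`. -/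
def Clause.restrict (q : PAssign V) (C : Clause V) : Clause V :=
  C.filter fun l => q l.var ≠ some (!l.pos)

/-- The cofactor `F|_q` of a CNF formula: drop the clauses satisfied by `q`
(they became `true`) and remove the falsified literals from the remaining clauses. -/
def Cnf.restrict (q : PAssign V) (F : Cnf V) : Cnf V :=
  (F.filter fun C => ¬ Clause.satBy q C).image (Clause.restrict q)

/-- The formula `∃X.F` evaluates to true at the point `t`. -/
def ExSat (X : Finset V) (F : Cnf V) (t : V → Bool) : Prop :=
  ∃ t' : V → Bool, (∀ v, v ∉ X → t' v = t v) ∧ Cnf.satAt t' F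

/-- Equivalence `∃X.F ≡ ∃X.G`. -/
def Eqv (X : Finset V) (F G : Cnf V) : Prop := ∀ t : V → Bool, ExSat X F t ↔ ExSat X G t

/-- The set `G` of clauses of `F` is redundant in `∃X.F`, i.e. `∃X.F ≡ ∃X.(F \ G)`. -/
def RedundantSet (X : Finset V) (F G : Cnf V) : Prop := Eqv X F (F \ G)

/-- The CNF formula `F` implies the clause `C`. -/
def CnfImplies (F : Cnf V) (C : Clause V) : Prop :=
  ∀ t : V → Bool, Cnf.satAt t F → Clause.satAt t C

/-- The CNF formula `F` implies the CNF formula `R`. -/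
def CnfImpliesCnf (F R : Cnf V) : Prop :=
  ∀ t : V → Bool, Cnf.satAt t F → Cnf.satAt t R

/-- `C` is a `Z`-clause, i.e. `Vars(C) ∩ Z ≠ ∅`. -/
def XClause (Z : Finset V) (C : Clause V) : Prop := (Clause.vars C ∩ Z).Nonempty

/-- The point `p` is a `Z`-boundary point of `F`. -/
def BoundaryPnt (F : Cnf V) (Z : Finset V) (p : V → Bool) : Prop :=
  Z.Nonempty ∧ Z ⊆ Cnf.vars F ∧ ¬ Cnf.satAt p F ∧
  (∀ C ∈ F, Clause.falsAt p C → XClause Z C) ∧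
  ∀ Z' ⊂ Z, ¬ ∀ C ∈ F, Clause.falsAt p C → XClause Z' C

/-- The point `p` is `X'`-removable in `F`: there is a clause `C` implied by `F`,
with no variable in `X'`, falsified by `p`. -/
def Removable (F : Cnf V) (X' : Finset V) (p : V → Bool) : Prop :=
  ∃ C : Clause V, CnfImplies F C ∧ Clause.vars C ∩ X' = ∅ ∧ Clause.falsAt p C

/-- `q*`: remove from `q` all value assignments to variables of `X`. -/
def stripX (X : Finset V) (q : PAssign V) : PAssign V := fun v => if v ∈ X then none else q v

/-- The clause `C|_q` is virtually redundant in `∃X.(F|_q)`: for every point `p`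
such that the only clause of `F|_q` falsified by `p` is `C|_q` and `p` is
`X`-removable in `F|_q`, there is an assignment `r` with `q* ⊆ r ⊊ q` such that
`p` is not `X`-removable in `F|_r`.  (If the set of such points `p` is empty
this holds vacuously, which is exactly regular redundancy.) -/
def VirtRed (X : Finset V) (F : Cnf V) (q : PAssign V) (C : Clause V) : Prop :=
  ∀ p : V → Bool,
    Clause.falsAt p (Clause.restrict q C) →
    (∀ D ∈ Cnf.restrict q F, Clause.falsAt p D → D = Clause.restrict q C) →
    Removable (Cnf.restrict q F) X p →
    ∃ r : PAssign V, PAssign.le (stripX X q) r ∧ PAssign.lt r q ∧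
      ¬ Removable (Cnf.restrict r F) X p

/-- The D-sequent `(∃X.F, q, H) → C` holds: for every member formula `W` with
`H ∪ {C} ⊆ W ⊆ F` such that `∃X.(W|_q) ≡ ∃X.(F|_q)`, the clause `C|_q` is
(at least virtually) redundant in `∃X.(W|_q)`. -/
def IsDseq (X : Finset V) (F : Cnf V) (q : PAssign V) (H : Cnf V) (C : Clause V) : Prop :=
  ∀ W : Cnf V, H ∪ {C} ⊆ W → W ⊆ F →
    Eqv X (Cnf.restrict q W) (Cnf.restrict q F) → VirtRed X W q C

/-- Consistency of the set of D-sequents `(q^i, H_i) → C_i`, `i = 1,…,k`: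
the conditionals are pairwise compatible and there is a total order `π` on the
clauses of `⋃ᵢ (H_i ∪ {C_i})` satisfying the order constraints. -/
def Consistent {k : ℕ} (qs : Fin k → PAssign V) (Hs : Fin k → Cnf V)
    (Cs : Fin k → Clause V) : Prop :=
  (∀ i j, PAssign.compatible (qs i) (qs j)) ∧
  ∃ π : Clause V → ℕ,
    Set.InjOn π (⋃ i, ((Hs i ∪ {Cs i} : Cnf V) : Set (Clause V))) ∧
    ∀ i, ∀ D ∈ Hs i, π (Cs i) < π D

/-- Clauses `C` and `D` are resolvable on `v`: they have opposite literals of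
exactly one variable, namely `v`. -/
def ClResolvable (C D : Clause V) (v : V) : Prop :=
  (∃ b : Bool, (⟨v, b⟩ : Lit V) ∈ C ∧ (⟨v, !b⟩ : Lit V) ∈ D) ∧
  ∀ u, u ≠ v → ∀ b : Bool, (⟨u, b⟩ : Lit V) ∈ C → (⟨u, !b⟩ : Lit V) ∉ D

/-- The clause `C` is blocked at variable `v` in the CNF formula `G`. -/
def Blocked (G : Cnf V) (C : Clause V) (v : V) : Prop := ∀ D ∈ G, ¬ ClResolvable C D v

/-- Assignments `q` and `r` are resolvable on `v`: exactly one commonly assigned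
variable, namely `v`, is assigned different values. -/
def PResolvable (q r : PAssign V) (v : V) : Prop :=
  (∃ b : Bool, q v = some b ∧ r v = some (!b)) ∧
  ∀ u, u ≠ v → ∀ b b' : Bool, q u = some b → r u = some b' → b = b'

/-- The resolvent of assignments `q` and `r` on `v`: all value assignments of
`q` and `r` except those to `v`. -/
def PResolvent (q r : PAssign V) (v : V) : PAssign V :=
  fun u => if u = v then none else (q u).orElse fun _ => r u

theorem not_satAt_iff_falsAt (t : V → Bool) (C : Clause V) :
    ¬ Clause.satAt t C ↔ Clause.falsAt t C := by
  unfold Clause.satAt Clause.falsAt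
  push Not
  refine forall₂_congr fun l _ => ?_
  cases t l.var <;> cases l.pos <;> simp

theorem mem_vars_of_mem {F : Cnf V} {C : Clause V} {l : Lit V} (hC : C ∈ F) (hl : l ∈ C) :
    l.var ∈ Cnf.vars F :=
  (Finset.le_sup (f := Clause.vars) hC : Clause.vars C ⊆ Cnf.vars F)
    (Finset.mem_image_of_mem _ hl)

theorem xclause_inter {F : Cnf V} {C : Clause V} {X : Finset V} (hC : C ∈ F)
    (h : XClause X C) : XClause (X ∩ Cnf.vars F) C := by
  obtain ⟨v, hv⟩ := h
  rw [Finset.mem_inter] at hv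
  refine ⟨v, Finset.mem_inter.2 ⟨hv.1, Finset.mem_inter.2 ⟨hv.2, ?_⟩⟩⟩
  exact (Finset.le_sup (f := Clause.vars) hC : Clause.vars C ⊆ Cnf.vars F) hv.1

/-- Existence of a minimal `Z`. -/
theorem exists_boundary {F : Cnf V} {X : Finset V} {p : V → Bool}
    (hp : ¬ Cnf.satAt p F) (h : ∀ C ∈ F, Clause.falsAt p C → XClause X C) :
    ∃ Z ⊆ X, BoundaryPnt F Z p := by
  have h0 : ∀ C ∈ F, Clause.falsAt p C → XClause (X ∩ Cnf.vars F) C :=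
    fun C hC hf => xclause_inter hC (h C hC hf)
  obtain ⟨Z, hZle, hZ⟩ := exists_minimal_le_of_wellFoundedLT
    (fun Z : Finset V => ∀ C ∈ F, Clause.falsAt p C → XClause Z C) _ h0
  refine ⟨Z, fun v hv => (Finset.mem_inter.1 (hZle hv)).1, ?_,
    fun v hv => (Finset.mem_inter.1 (hZle hv)).2, hp, hZ.prop, ?_⟩
  · unfold Cnf.satAt at hp
    push Not at hp
    obtain ⟨C, hC, hs⟩ := hp
    obtain ⟨v, hv⟩ := hZ.prop C hC ((not_satAt_iff_falsAt _ _).1 hs)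
    exact ⟨v, (Finset.mem_inter.1 hv).2⟩
  · intro Z' hZ' hall
    exact hZ.not_prop_of_lt hZ' hall

/-- A nonempty set `G ⊆ F^X` is not redundant in `∃X.F` iff there is a
`Z`-boundary point `p` of `F` (`Z ⊆ X`) such that every clause of `F` falsified by `p`
is in `G` and `p` is `X`-removable in `F`. -/
theorem not_redundant_iff_removable_boundary_point
    (X Y : Finset V) (F : Cnf V) (hXY : Disjoint X Y) (hFvars : Cnf.vars F ⊆ X ∪ Y)
    (hFX : (F.filter (XClause X)).Nonempty)
    (G : Cnf V) (hGne : G.Nonempty) (hG : G ⊆ F.filter (XClause X)) :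
    ¬ RedundantSet X F G ↔
      ∃ Z : Finset V, Z ⊆ X ∧ ∃ p : V → Bool,
        BoundaryPnt F Z p ∧ (∀ C ∈ F, Clause.falsAt p C → C ∈ G) ∧ Removable F X p := by
  constructor
  · intro hR
    unfold RedundantSet Eqv at hR
    push Not at hR
    obtain ⟨t, ht⟩ := hR
    have hmono : ExSat X F t → ExSat X (F \ G) t := by
      rintro ⟨s, hs, hsat⟩
      exact ⟨s, hs, fun C hC => hsat C (Finset.mem_sdiff.1 hC).1⟩
    have hnF : ¬ ExSat X F t := by tauto
    have hFG : ExSat X (F \ G) t := by tauto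
    obtain ⟨p, hpt, hp⟩ := hFG
    have hpF : ¬ Cnf.satAt p F := fun h => hnF ⟨p, hpt, h⟩
    have hfG : ∀ C ∈ F, Clause.falsAt p C → C ∈ G := by
      intro C hC hf
      by_contra hCG
      exact (not_satAt_iff_falsAt _ _).2 hf (hp C (Finset.mem_sdiff.2 ⟨hC, hCG⟩))
    obtain ⟨Z, hZX, hZ⟩ := exists_boundary (X := X) hpF
      (fun C hC hf => (Finset.mem_filter.1 (hG (hfG C hC hf))).2)
    refine ⟨Z, hZX, p, hZ, hfG, ?_⟩
    refine ⟨(Cnf.vars F \ X).image (fun v => (⟨v, !p v⟩ : Lit V)), ?_, ?_, ?_⟩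
    · intro s hs
      by_contra hns
      rw [not_satAt_iff_falsAt] at hns
      apply hnF
      refine ⟨fun v => if v ∈ X then s v else t v, fun v hv => by simp [hv], ?_⟩
      intro C hC
      obtain ⟨l, hl, hsl⟩ := hs C hC
      refine ⟨l, hl, ?_⟩
      by_cases hX : l.var ∈ X
      · simp [hX, hsl]
      · have := hns ⟨l.var, !p l.var⟩ (Finset.mem_image.2
          ⟨l.var, Finset.mem_sdiff.2 ⟨mem_vars_of_mem hC hl, hX⟩, rfl⟩)
        simp only [Bool.not_not] at this
        simp only [hX, if_false]
        rw [← hpt _ hX, ← this, hsl]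
    · ext v
      simp only [Clause.vars, Finset.mem_inter, Finset.mem_image, Finset.mem_sdiff]
      constructor
      · rintro ⟨⟨l, ⟨u, hu, rfl⟩, rfl⟩, hv⟩
        exact absurd hv hu.2
      · intro h
        simp at h
    · intro l hl
      obtain ⟨u, hu, rfl⟩ := Finset.mem_image.1 hl
      simp
  · rintro ⟨Z, hZX, p, hZ, hfG, C, himp, hCX, hCf⟩ hR
    have h1 : ExSat X (F \ G) p := by
      refine ⟨p, fun _ _ => rfl, fun D hD => ?_⟩
      rw [Finset.mem_sdiff] at hD
      by_contra hns
      exact hD.2 (hfG D hD.1 ((not_satAt_iff_falsAt _ _).1 hns))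
    obtain ⟨s, hsp, hs⟩ := (hR p).2 h1
    obtain ⟨l, hl, hsl⟩ := himp s hs
    have hlX : l.var ∉ X := by
      intro h
      have : l.var ∈ Clause.vars C ∩ X :=
        Finset.mem_inter.2 ⟨Finset.mem_image_of_mem _ hl, h⟩
      rw [hCX] at this
      simp at this
    have h2 := hCf l hl
    rw [← hsp _ hlX, hsl] at h2
    simp at h2

end

end QE
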